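/- Let G be a TLG on {1,…,N} (N ≥ 3) in which vertex 1 is adjacent exactly to vertices 2 and 3 and (2,3) ∈ E, let (f_ij) ∈ 𝓕^{|E|}, and let p be an equilibrium line configuration on the a-axis with distances d_12 = |x_1−x_2|, d_13 = |x_1−x_3|. Set H_p := diag(d̃F_p, F_p) and H_{p*} := diag(d̃F_{p*}, F_{p*}), where F_{p*}, d̃F_{p*} are formed for the reduced system associated with p at the sub-configuration p* = (x_2,…,x_N). Then 𝐧(H_p) − 𝐧(H_{p*}) = sgn(−f_12(d_12) − f_13(d_13)) + sgn(−f̃′_12(d_12) − f̃′_13(d_13)). -/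

import Mathlib

open Set Filter Topology MeasureTheory Matrix Function

attribute [local instance] Classical.propDecidable

noncomputable section

/-- `f̃(d) = d * f(d)`. -/
def tildeFn (f : ℝ → ℝ) : ℝ → ℝ := fun d => d * f d

/-- Membership in the class `𝓕` of monotone interaction laws:
`f` is `C¹` on `ℝ₊ = (0,∞)`, `f̃′ > 0` on `ℝ₊`, `f̃` has a zero, and
`∫_d^1 f̃(x) dx → −∞` as `d → 0⁺`. -/
def MemF (f : ℝ → ℝ) : Prop :=
  ContDiffOn ℝ 1 f (Set.Ioi 0) ∧
  (∀ d > (0:ℝ), 0 < deriv (tildeFn f) d) ∧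
  (∃ d > (0:ℝ), tildeFn f d = 0) ∧
  Tendsto (fun d => ∫ x in d..(1:ℝ), tildeFn f x) (𝓝[>] (0:ℝ)) atBot

/-- The space `C¹(ℝ₊, ℝ)`. -/
def C1Pos : Type := {f : ℝ → ℝ // ContDiffOn ℝ 1 f (Set.Ioi 0)}

/-- The Whitney `C¹`-topology on `C¹(ℝ₊, ℝ)`, generated by the basic open sets
`B_δ(f) = {g : |g(d) − f(d)| + |g′(d) − f′(d)| < δ(d) for all d > 0}`. -/
instance : TopologicalSpace C1Pos :=
  TopologicalSpace.generateFrom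
    { S | ∃ (f : C1Pos) (δ : ℝ → ℝ), ContinuousOn δ (Set.Ioi 0) ∧ (∀ d > (0:ℝ), 0 < δ d) ∧
        S = { g : C1Pos | ∀ d > (0:ℝ), |g.1 d - f.1 d| + |deriv g.1 d - deriv f.1 d| < δ d } }

/-- The class `𝓕` as a topological space (subspace of `C¹(ℝ₊,ℝ)`). -/
def FF : Type := {f : C1Pos // MemF f.1}

instance : TopologicalSpace FF := instTopologicalSpaceSubtype

/-- `G` is a triangulated Laman graph: there is a Henneberg-type construction order
(a relabeling `σ`) starting from the edge between the first two vertices, in which every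
later vertex is joined to exactly two earlier, adjacent, vertices. -/
def IsTLG {N : ℕ} (G : SimpleGraph (Fin N)) : Prop :=
  2 ≤ N ∧
  ∃ (σ : Equiv.Perm (Fin N)) (par₁ par₂ : Fin N → Fin N),
    (∀ k : Fin N, 2 ≤ (k : ℕ) →
      ((par₁ k : ℕ) < (k : ℕ) ∧ (par₂ k : ℕ) < (k : ℕ) ∧ par₁ k ≠ par₂ k ∧
        G.Adj (σ (par₁ k)) (σ (par₂ k)))) ∧
    (∀ i j : Fin N, G.Adj (σ i) (σ j) ↔
      (((i : ℕ) = 0 ∧ (j : ℕ) = 1) ∨ ((i : ℕ) = 1 ∧ (j : ℕ) = 0) ∨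
       (2 ≤ (i : ℕ) ∧ (j = par₁ i ∨ j = par₂ i)) ∨
       (2 ≤ (j : ℕ) ∧ (i = par₁ j ∨ i = par₂ j))))

/-- Euclidean distance on `ℝ²` (coordinates `(a,b)`). -/
def dist2 (x y : ℝ × ℝ) : ℝ := Real.sqrt ((x.1 - y.1)^2 + (x.2 - y.2)^2)

/-- `p` belongs to the configuration space `P`: no collision of adjacent agents. -/
def InConfigSpace {N : ℕ} (G : SimpleGraph (Fin N)) (p : Fin N → ℝ × ℝ) : Prop :=
  ∀ i j, G.Adj i j → p i ≠ p j

/-- `p` is an equilibrium of the RMA system `ẋᵢ = Σ_{j : (i,j) ∈ E} f_ij(d_ij)(x_j − x_i)`. -/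
def IsEquilibrium {N : ℕ} (G : SimpleGraph (Fin N)) (f : Fin N → Fin N → ℝ → ℝ)
    (p : Fin N → ℝ × ℝ) : Prop :=
  ∀ i, (∑ j, if G.Adj i j then (f i j (dist2 (p i) (p j))) • (p j - p i) else (0:ℝ×ℝ)) = 0

/-- The potential function `Φ(p) = Σ_{(i,j) ∈ E} ∫_1^{d_ij} x f_ij(x) dx`
(each edge counted once; the factor 1/2 compensates the double count over ordered pairs). -/
def potential {N : ℕ} (G : SimpleGraph (Fin N)) (f : Fin N → Fin N → ℝ → ℝ)
    (p : Fin N → ℝ × ℝ) : ℝ :=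
  (1/2) * ∑ i, ∑ j, if G.Adj i j then ∫ x in (1:ℝ)..(dist2 (p i) (p j)), x * f i j x else 0

/-- Coordinate directions on the configuration space, in the order `(a₁,…,a_N,b₁,…,b_N)`. -/
def basisVec {N : ℕ} : (Fin N ⊕ Fin N) → (Fin N → ℝ × ℝ) :=
  Sum.elim (fun i => Pi.single i ((1:ℝ), (0:ℝ))) (fun i => Pi.single i ((0:ℝ), (1:ℝ)))

/-- The Hessian matrix of `Φ` at `p` in the coordinates `(a₁,…,a_N,b₁,…,b_N)`. -/
def hessian {N : ℕ} (Φ : (Fin N → ℝ × ℝ) → ℝ) (p : Fin N → ℝ × ℝ) :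
    Matrix (Fin N ⊕ Fin N) (Fin N ⊕ Fin N) ℝ :=
  Matrix.of fun u v => fderiv ℝ (fun q => fderiv ℝ Φ q (basisVec v)) p (basisVec u)

/-- The inertia `𝐧(M) = (n₊(M), n₀(M), n₋(M))` of a real symmetric matrix: the numbers of
positive, zero, and negative eigenvalues (counted with multiplicity). -/
def inertia {m : Type*} [Fintype m] [DecidableEq m] (M : Matrix m m ℝ) : ℕ × ℕ × ℕ :=
  if h : M.IsHermitian then
    ((Finset.univ.filter fun i => 0 < h.eigenvalues i).card,
     (Finset.univ.filter fun i => h.eigenvalues i = 0).card,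
     (Finset.univ.filter fun i => h.eigenvalues i < 0).card)
  else (0, 0, 0)

/-- The number `n₀(M)` of zero eigenvalues of a real symmetric matrix. -/
def n0 {m : Type*} [Fintype m] [DecidableEq m] (M : Matrix m m ℝ) : ℕ := (inertia M).2.1

/-- The vector-valued sign function. -/
def sgn3 (x : ℝ) : ℕ × ℕ × ℕ :=
  if 0 < x then (1,0,0) else if x = 0 then (0,1,0) else (0,0,1)

/-- `q` lies in the `SE(2)`-orbit of `p` (rigid motions: rotation by `(c,s)` with
`c² + s² = 1` followed by translation by `(vx,vy)`). -/
def sameOrbit {N : ℕ} (p q : Fin N → ℝ × ℝ) : Prop :=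
  ∃ c s vx vy : ℝ, c^2 + s^2 = 1 ∧
    ∀ i, q i = (c * (p i).1 - s * (p i).2 + vx, s * (p i).1 + c * (p i).2 + vy)

/-- The interaction laws determined by an ensemble `ω ∈ 𝓕^{|E|}`. -/
def ensembleLaws {N : ℕ} {G : SimpleGraph (Fin N)} (ω : G.edgeSet → FF) :
    Fin N → Fin N → ℝ → ℝ :=
  fun i j => if h : G.Adj i j then (ω ⟨s(i,j), G.mem_edgeSet.mpr h⟩).1.1 else 0

/-- The line configuration on the `a`-axis with coordinates `a`. -/
def lineConfig {N : ℕ} (a : Fin N → ℝ) : Fin N → ℝ × ℝ := fun i => (a i, 0)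

/-- The matrix `F_p` of a line configuration with coordinates `a`: symmetric, zero row sums,
off-diagonal entries `φ_ij(d_ij)` on edges and `0` otherwise. -/
def FMat {N : ℕ} (G : SimpleGraph (Fin N)) (φ : Fin N → Fin N → ℝ → ℝ)
    (a : Fin N → ℝ) : Matrix (Fin N) (Fin N) ℝ :=
  Matrix.of fun i j =>
    if i = j then -∑ k, (if G.Adj i k then φ i k |a i - a k| else 0)
    else if G.Adj i j then φ i j |a i - a j| else 0

/-- The matrix `d̃F_p`: off-diagonal entries `f̃′_ij(d_ij)` on edges. -/
def dFMat {N : ℕ} (G : SimpleGraph (Fin N)) (f : Fin N → Fin N → ℝ → ℝ)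
    (a : Fin N → ℝ) : Matrix (Fin N) (Fin N) ℝ :=
  FMat G (fun i j d => deriv (tildeFn (f i j)) d) a

/-- Case 1 balanced distance: the (generically unique) `d₁₂(d)` with `0 < d₁₂ < d` and
`f̃₁₂(d₁₂) = f̃₁₃(d − d₁₂)`. -/
def case1d12 (f12 f13 : ℝ → ℝ) (d : ℝ) : ℝ :=
  Classical.epsilon fun t => 0 < t ∧ t < d ∧ tildeFn f12 t = tildeFn f13 (d - t)

/-- The case-1 virtual interaction: `g̃₂₃(d) = f̃₁₂(d₁₂(d))`. -/
def g23Case1 (f12 f13 : ℝ → ℝ) : ℝ → ℝ :=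
  fun d => tildeFn f12 (case1d12 f12 f13 d) / d

/-- Case 2 balanced distance: the (generically unique) `d₁₂(d) > 0` with
`f̃₁₂(d₁₂) + f̃₁₃(d₁₂ + d) = 0`. -/
def case2d12 (f12 f13 : ℝ → ℝ) (d : ℝ) : ℝ :=
  Classical.epsilon fun t => 0 < t ∧ tildeFn f12 t + tildeFn f13 (t + d) = 0

/-- The case-2 virtual interaction: `g̃₂₃(d) = f̃₁₃(d₁₃(d))`, `d₁₃(d) = d₁₂(d) + d`. -/
def g23Case2 (f12 f13 : ℝ → ℝ) : ℝ → ℝ :=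
  fun d => tildeFn f13 (case2d12 f12 f13 d + d) / d

/-- The case-3 virtual interaction: case 2 with the roles of agents 2,3 (and `f₁₂`,`f₁₃`)
interchanged. -/
def g23Case3 (f12 f13 : ℝ → ℝ) : ℝ → ℝ := g23Case2 f13 f12

/-- The virtual interaction between agents 2 and 3 induced by `f₁₂`, `f₁₃`, chosen according
to which of the three aligned agents (at coordinates `a1`, `a2`, `a3`) lies between the
other two. -/
def virtualG (f12 f13 : ℝ → ℝ) (a1 a2 a3 : ℝ) : ℝ → ℝ :=
  if (a2 < a1 ∧ a1 < a3) ∨ (a3 < a1 ∧ a1 < a2) then g23Case1 f12 f13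
  else if (a1 < a2 ∧ a2 < a3) ∨ (a3 < a2 ∧ a2 < a1) then g23Case2 f12 f13
  else g23Case3 f12 f13

/-- The interaction laws of the reduced system: vertex `0` (the last Henneberg vertex,
the paper's vertex 1) is deleted, reduced vertex `i` is original vertex `i+1`, and the law on
the reduced edge `(0,1)` (the paper's edge `(2,3)`) is `f*₂₃ = f₂₃ + g₂₃`. -/
def reducedLaws {n : ℕ} (f : Fin (n+3) → Fin (n+3) → ℝ → ℝ) (g : ℝ → ℝ) :
    Fin (n+2) → Fin (n+2) → ℝ → ℝ :=
  fun i j => if (i = 0 ∧ j = 1) ∨ (i = 1 ∧ j = 0)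
    then fun d => f i.succ j.succ d + g d
    else f i.succ j.succ

end


/-! ### Inertia of symmetric matrices -/

lemma dotProduct_mulVec_eq_sum_eigenvalues {m : Type*} [Fintype m] [DecidableEq m]
    {M : Matrix m m ℝ} (hM : M.IsHermitian) :
    ∃ e : (m → ℝ) ≃ₗ[ℝ] (m → ℝ), ∀ x, x ⬝ᵥ M *ᵥ x = ∑ i, hM.eigenvalues i * (e x i * e x i) := by
  set U : Matrix m m ℝ := (hM.eigenvectorUnitary : Matrix m m ℝ) with hU
  have h1 : U * star U = 1 := Unitary.coe_mul_star_self _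
  have h2 : star U * U = 1 := Unitary.coe_star_mul_self _
  have hsp : M = U * diagonal hM.eigenvalues * star U := by
    have := hM.spectral_theorem
    rw [Unitary.conjStarAlgAut_apply] at this
    exact this
  refine ⟨Matrix.toLin'OfInv h1 h2, fun x => ?_⟩
  have hx : ∀ i, Matrix.toLin'OfInv h1 h2 x i = (star U *ᵥ x) i := fun i => rfl
  simp only [hx]
  conv_lhs => rw [hsp]
  rw [← mulVec_mulVec, ← mulVec_mulVec, dotProduct_mulVec, ← mulVec_transpose]
  have : Uᵀ = star U := by simp [star_eq_conjTranspose]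
  rw [this, dotProduct]
  refine Finset.sum_congr rfl fun i _ => ?_
  rw [mulVec_diagonal]
  ring

lemma ncard_trichotomy {κ : Type*} [Fintype κ] (v : κ → ℝ) :
    {i | 0 < v i}.ncard + {i | v i = 0}.ncard + {i | v i < 0}.ncard = Fintype.card κ := by
  rw [← Set.ncard_union_eq, ← Set.ncard_union_eq, ← Nat.card_eq_fintype_card, ← Set.ncard_univ]
  · congr 1
    ext i
    rcases lt_trichotomy (v i) 0 with h | h | h <;> simp [h]
  · rw [Set.disjoint_left]
    rintro i (h | h) <;> simp only [Set.mem_ofPred_eq] at * <;> linarith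
  · rw [Set.disjoint_left]
    intro i h
    simp only [Set.mem_ofPred_eq] at *
    linarith

/-- **Sylvester's law of inertia**: the inertia of a symmetric matrix is read off from any
diagonalization of its quadratic form. -/
lemma inertia_eq_of_dotProduct_mulVec_eq {m ι : Type*} [Fintype m] [DecidableEq m] [Fintype ι]
    {M : Matrix m m ℝ} (hM : M.IsHermitian) (e : (m → ℝ) ≃ₗ[ℝ] (ι → ℝ)) (w : ι → ℝ)
    (h : ∀ x, x ⬝ᵥ M *ᵥ x = ∑ i, w i * (e x i * e x i)) :
    inertia M = ({i | 0 < w i}.ncard, {i | w i = 0}.ncard, {i | w i < 0}.ncard) := by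
  obtain ⟨e', he'⟩ := dotProduct_mulVec_eq_sum_eigenvalues hM
  have hequiv : (QuadraticMap.weightedSumSquares ℝ hM.eigenvalues).Equivalent
      (QuadraticMap.weightedSumSquares ℝ w) := by
    refine ⟨⟨e'.symm.trans e, fun x => ?_⟩⟩
    have h1 := h (e'.symm x)
    rw [he'] at h1
    simpa [QuadraticMap.weightedSumSquares_apply] using h1.symm
  have hpos := hequiv.sigPos_eq
  have hneg := hequiv.sigNeg_eq
  rw [QuadraticForm.sigPos_weightedSumSquares, QuadraticForm.sigPos_weightedSumSquares] at hpos
  rw [QuadraticForm.sigNeg_weightedSumSquares, QuadraticForm.sigNeg_weightedSumSquares] at hneg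
  have hcard : Fintype.card m = Fintype.card ι := by
    simpa using e.finrank_eq
  have k1 := ncard_trichotomy hM.eigenvalues
  have k2 := ncard_trichotomy w
  have hfin : ∀ (p : m → Prop) [DecidablePred p],
      (Finset.univ.filter p).card = {i | p i}.ncard := by
    intro p _
    rw [← Set.ncard_coe_finset]
    simp
  rw [inertia, dif_pos hM]
  simp only [hfin, Prod.mk.injEq]
  omega

lemma inertia_eq_ncard_eigenvalues {m : Type*} [Fintype m] [DecidableEq m]
    {M : Matrix m m ℝ} (hM : M.IsHermitian) :
    inertia M = ({i | 0 < hM.eigenvalues i}.ncard, {i | hM.eigenvalues i = 0}.ncard,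
      {i | hM.eigenvalues i < 0}.ncard) := by
  obtain ⟨e, he⟩ := dotProduct_mulVec_eq_sum_eigenvalues hM
  exact inertia_eq_of_dotProduct_mulVec_eq hM e _ he

lemma ncard_setOf_sumElim {ι κ : Type*} [Finite ι] [Finite κ] (v : ι → ℝ) (w : κ → ℝ)
    (p : ℝ → Prop) :
    {i | p (Sum.elim v w i)}.ncard = {i | p (v i)}.ncard + {i | p (w i)}.ncard := by
  have : {i | p (Sum.elim v w i)} = Sum.inl '' {i | p (v i)} ∪ Sum.inr '' {i | p (w i)} := by
    ext (i | i) <;> simp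
  rw [this, Set.ncard_union_eq, Set.ncard_image_of_injective _ Sum.inl_injective,
    Set.ncard_image_of_injective _ Sum.inr_injective]
  rw [Set.disjoint_left]
  rintro _ ⟨i, -, rfl⟩ ⟨j, -, h⟩
  cases h

lemma inertia_fromBlocks_zero {m k : Type*} [Fintype m] [DecidableEq m] [Fintype k]
    [DecidableEq k] [DecidableEq (m ⊕ k)] {A : Matrix m m ℝ} {B : Matrix k k ℝ}
    (hA : A.IsHermitian) (hB : B.IsHermitian) :
    inertia (Matrix.fromBlocks A 0 0 B) = inertia A + inertia B := by
  obtain ⟨eA, heA⟩ := dotProduct_mulVec_eq_sum_eigenvalues hA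
  obtain ⟨eB, heB⟩ := dotProduct_mulVec_eq_sum_eigenvalues hB
  have hM : (Matrix.fromBlocks A 0 0 B).IsHermitian :=
    Matrix.IsHermitian.fromBlocks hA (by simp) hB
  rw [inertia_eq_of_dotProduct_mulVec_eq hM
    ((LinearEquiv.sumArrowLequivProdArrow m k ℝ ℝ).trans
      ((eA.prodCongr eB).trans (LinearEquiv.sumArrowLequivProdArrow m k ℝ ℝ).symm))
    (Sum.elim hA.eigenvalues hB.eigenvalues), inertia_eq_ncard_eigenvalues hA,
    inertia_eq_ncard_eigenvalues hB]
  · simp only [ncard_setOf_sumElim _ _ (fun t => 0 < t), ncard_setOf_sumElim _ _ (fun t => t = 0),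
      ncard_setOf_sumElim _ _ (fun t => t < 0), Prod.mk_add_mk]
  · intro x
    have h1 := heA (x ∘ Sum.inl)
    have h2 := heB (x ∘ Sum.inr)
    rw [fromBlocks_mulVec]
    conv_lhs => rw [← Sum.elim_comp_inl_inr x]
    rw [sumElim_dotProduct_sumElim]
    simp only [Sum.elim_comp_inl, Sum.elim_comp_inr, zero_mulVec, add_zero, zero_add, h1, h2,
      Fintype.sum_sum_type]
    rfl

lemma sgn3_eq_ncard (α : ℝ) :
    sgn3 α = ({_i : Unit | 0 < α}.ncard, {_i : Unit | α = 0}.ncard, {_i : Unit | α < 0}.ncard) := by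
  unfold sgn3
  rcases lt_trichotomy α 0 with h | h | h
  · simp [h, h.not_gt, h.ne]
  · simp [h]
  · simp [h, h.not_gt, h.ne']

/-- Completing the square in the first coordinate. -/
lemma inertia_of_complete_square {N : ℕ} [DecidableEq (Fin (N + 1))] [DecidableEq (Fin N)]
    {M : Matrix (Fin (N + 1)) (Fin (N + 1)) ℝ}
    {M' : Matrix (Fin N) (Fin N) ℝ} (hM : M.IsHermitian) (hM' : M'.IsHermitian) (α : ℝ)
    (c : Fin N → ℝ)
    (h : ∀ x : Fin (N + 1) → ℝ, x ⬝ᵥ M *ᵥ x =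
      α * (x 0 + c ⬝ᵥ (x ∘ Fin.succ)) ^ 2 + (x ∘ Fin.succ) ⬝ᵥ M' *ᵥ (x ∘ Fin.succ)) :
    inertia M = inertia M' + sgn3 α := by
  obtain ⟨e', he'⟩ := dotProduct_mulVec_eq_sum_eigenvalues hM'
  let e : (Fin (N + 1) → ℝ) ≃ₗ[ℝ] (Fin N ⊕ Unit → ℝ) :=
    { toFun := fun x => Sum.elim (e' (x ∘ Fin.succ)) (fun _ => x 0 + c ⬝ᵥ (x ∘ Fin.succ))
      map_add' := fun x y => by
        have : (x + y) ∘ Fin.succ = x ∘ Fin.succ + y ∘ Fin.succ := rfl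
        ext (i | i)
        · simp [this]
        · simp [this, dotProduct_add]; ring
      map_smul' := fun r x => by
        have : (r • x) ∘ Fin.succ = r • (x ∘ Fin.succ) := rfl
        ext (i | i)
        · simp [this]
        · simp [this, dotProduct_smul]; ring
      invFun := fun y => Fin.cons (y (Sum.inr ()) - c ⬝ᵥ e'.symm (y ∘ Sum.inl))
        (e'.symm (y ∘ Sum.inl))
      left_inv := fun x => by
        ext i
        refine Fin.cases ?_ (fun j => ?_) i
        · simp
        · simp
      right_inv := fun y => by
        have : ∀ (u : ℝ) (v : Fin N → ℝ),
            (Fin.cons u v : Fin (N + 1) → ℝ) ∘ Fin.succ = v := fun u v => by ext; simp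
        ext (i | i)
        · simp [this]
        · simp [this] }
  rw [inertia_eq_of_dotProduct_mulVec_eq hM e (Sum.elim hM'.eigenvalues (fun _ => α)),
    inertia_eq_ncard_eigenvalues hM', sgn3_eq_ncard]
  · simp only [ncard_setOf_sumElim _ _ (fun t => 0 < t), ncard_setOf_sumElim _ _ (fun t => t = 0),
      ncard_setOf_sumElim _ _ (fun t => t < 0), Prod.mk_add_mk]
  · intro x
    rw [h, he', Fintype.sum_sum_type]
    simp [e]
    ring

/-! ### Weighted graph matrices -/

lemma FMat_isHermitian {N : ℕ} (G : SimpleGraph (Fin N)) {φ : Fin N → Fin N → ℝ → ℝ}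
    (hφ : ∀ i j, φ i j = φ j i) (a : Fin N → ℝ) : (FMat G φ a).IsHermitian := by
  ext i j
  by_cases h : i = j
  · simp [FMat, h]
  · simp [FMat, h, Ne.symm h, G.adj_comm i j, hφ i j, abs_sub_comm (a i)]

lemma dotProduct_FMat_mulVec {N : ℕ} (G : SimpleGraph (Fin N)) {φ : Fin N → Fin N → ℝ → ℝ}
    (hφ : ∀ i j, φ i j = φ j i) (a x : Fin N → ℝ) :
    x ⬝ᵥ FMat G φ a *ᵥ x = -(1 / 2) * ∑ i, ∑ j,
      (if G.Adj i j then φ i j |a i - a j| else 0) * (x i - x j) ^ 2 := by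
  set w : Fin N → Fin N → ℝ := fun i j => if G.Adj i j then φ i j |a i - a j| else 0 with hw
  have hwsym : ∀ i j, w i j = w j i := fun i j => by
    simp [hw, G.adj_comm i j, hφ i j, abs_sub_comm (a i)]
  have hM : FMat G φ a = Matrix.of w - diagonal (fun i => ∑ j, w i j) := by
    ext i j
    by_cases h : i = j
    · subst h
      simp [FMat, hw]
    · simp [FMat, hw, h]
  change _ = -(1 / 2) * ∑ i, ∑ j, w i j * (x i - x j) ^ 2
  have h1 : ∑ i, ∑ j, w i j * (x i - x j) ^ 2 =
      ∑ i, ∑ j, w i j * x i ^ 2 + ∑ i, ∑ j, w i j * x j ^ 2 - 2 * ∑ i, ∑ j, x i * (w i j * x j) := by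
    simp only [Finset.mul_sum, ← Finset.sum_add_distrib, ← Finset.sum_sub_distrib]
    refine Finset.sum_congr rfl fun i _ => Finset.sum_congr rfl fun j _ => ?_
    ring
  have h2 : ∑ i, ∑ j, w i j * x j ^ 2 = ∑ i, ∑ j, w i j * x i ^ 2 := by
    rw [Finset.sum_comm]
    refine Finset.sum_congr rfl fun i _ => Finset.sum_congr rfl fun j _ => ?_
    rw [hwsym]
  have h3 : x ⬝ᵥ FMat G φ a *ᵥ x =
      ∑ i, ∑ j, x i * (w i j * x j) - ∑ i, ∑ j, w i j * x i ^ 2 := by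
    rw [hM, sub_mulVec, dotProduct_sub]
    congr 1
    · simp [dotProduct, mulVec, Finset.mul_sum]
    · simp only [dotProduct, mulVec_diagonal, Finset.mul_sum, Finset.sum_mul]
      refine Finset.sum_congr rfl fun i _ => Finset.sum_congr rfl fun j _ => ?_
      ring
  rw [h1, h2, h3]
  ring

lemma sum_sum_succ {N : ℕ} {T : Fin (N + 1) → Fin (N + 1) → ℝ} (hsymm : ∀ i j, T i j = T j i)
    (h0 : T 0 0 = 0) :
    ∑ i, ∑ j, T i j = 2 * ∑ j : Fin N, T 0 j.succ + ∑ i : Fin N, ∑ j : Fin N, T i.succ j.succ := by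
  simp only [Fin.sum_univ_succ (n := N), Finset.sum_add_distrib, h0, fun i : Fin N => hsymm i.succ 0]
  ring

/-- Eliminating vertex `0`, adjacent exactly to `1` and `2`, adds the series weight
`w₁ w₂ / (w₁ + w₂)` to the edge `{1, 2}`. -/
lemma inertia_FMat_eq_comap_succ {n : ℕ} (G : SimpleGraph (Fin (n + 3)))
    [DecidableEq (Fin (n + 3))] [DecidableEq (Fin (n + 2))]
    (h0 : G.neighborSet 0 = {1, 2}) (h12 : G.Adj 1 2)
    {φ : Fin (n + 3) → Fin (n + 3) → ℝ → ℝ} (hφ : ∀ i j, φ i j = φ j i)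
    {ψ : Fin (n + 2) → Fin (n + 2) → ℝ → ℝ} (hψ : ∀ i j, ψ i j = ψ j i)
    (a : Fin (n + 3) → ℝ) {w₁ w₂ : ℝ} (hw₁ : φ 0 1 |a 0 - a 1| = w₁) (hw₂ : φ 0 2 |a 0 - a 2| = w₂)
    (hw : w₁ + w₂ = 0 → w₁ = 0 ∧ w₂ = 0)
    (hedge : ψ 0 1 |a 1 - a 2| = φ 1 2 |a 1 - a 2| + w₁ * w₂ / (w₁ + w₂))
    (hrest : ∀ i j, ¬ ((i = 0 ∧ j = 1) ∨ (i = 1 ∧ j = 0)) → ψ i j = φ i.succ j.succ) :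
    inertia (FMat G φ a) =
      inertia (FMat (G.comap Fin.succ) ψ (a ∘ Fin.succ)) + sgn3 (-w₁ - w₂) := by
  have hadj : ∀ j, G.Adj 0 j ↔ j = 1 ∨ j = 2 := fun j => by
    rw [← SimpleGraph.mem_neighborSet, h0]; rfl
  refine inertia_of_complete_square (FMat_isHermitian G hφ a) (FMat_isHermitian _ hψ _) _
    (Fin.cons (-w₁ / (w₁ + w₂)) (Fin.cons (-w₂ / (w₁ + w₂)) 0)) fun x => ?_
  rw [dotProduct_FMat_mulVec G hφ, dotProduct_FMat_mulVec _ hψ]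
  rw [sum_sum_succ (T := fun i j => (if G.Adj i j then φ i j |a i - a j| else 0) * (x i - x j) ^ 2)]
  rotate_left
  · intro i j
    simp only [G.adj_comm i j, hφ i j, abs_sub_comm (a i)]
    ring
  · simp
  have hs1 : (Fin.succ 0 : Fin (n + 3)) = 1 := rfl
  have hs2 : (Fin.succ 1 : Fin (n + 3)) = 2 := rfl
  have hs2' : (Fin.succ (Fin.succ 0) : Fin (n + 3)) = 2 := rfl
  have hs1' : (Fin.succ 0 : Fin (n + 2)) = 1 := rfl
  have hrow : ∑ j : Fin (n + 2), (if G.Adj 0 j.succ then φ 0 j.succ |a 0 - a j.succ| else 0) *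
      (x 0 - x j.succ) ^ 2 = w₁ * (x 0 - x 1) ^ 2 + w₂ * (x 0 - x 2) ^ 2 := by
    rw [Fin.sum_univ_succ, Fin.sum_univ_succ, Finset.sum_eq_zero, hs1, hs2',
      if_pos ((hadj 1).2 (Or.inl rfl)), if_pos ((hadj 2).2 (Or.inr rfl)), hw₁, hw₂]
    · ring
    · intro j _
      rw [if_neg, zero_mul]
      rw [hadj, ← hs1, ← hs2, Fin.succ_inj, Fin.succ_inj, ← hs1', Fin.succ_inj]
      simp [Fin.succ_ne_zero]
  have hblock : ∑ i : Fin (n + 2), ∑ j : Fin (n + 2),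
      (@ite ℝ ((G.comap Fin.succ).Adj i j) (Classical.propDecidable _)
        (ψ i j |(a ∘ Fin.succ) i - (a ∘ Fin.succ) j|) 0) *
        ((x ∘ Fin.succ) i - (x ∘ Fin.succ) j) ^ 2 =
      ∑ i : Fin (n + 2), ∑ j : Fin (n + 2),
        (if G.Adj i.succ j.succ then φ i.succ j.succ |a i.succ - a j.succ| else 0) *
          (x i.succ - x j.succ) ^ 2 + 2 * (w₁ * w₂ / (w₁ + w₂) * (x 1 - x 2) ^ 2) := by
    rw [← sub_eq_iff_eq_add', ← Finset.sum_sub_distrib]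
    simp only [← Finset.sum_sub_distrib]
    have hterm : ∀ i j : Fin (n + 2), ((@ite ℝ ((G.comap Fin.succ).Adj i j)
        (Classical.propDecidable _) (ψ i j |(a ∘ Fin.succ) i - (a ∘ Fin.succ) j|) 0) *
        ((x ∘ Fin.succ) i - (x ∘ Fin.succ) j) ^ 2 -
        (if G.Adj i.succ j.succ then φ i.succ j.succ |a i.succ - a j.succ| else 0) *
          (x i.succ - x j.succ) ^ 2) =
        (if i = 0 then if j = 1 then w₁ * w₂ / (w₁ + w₂) * (x 1 - x 2) ^ 2 else 0 else 0) +
        (if j = 0 then if i = 1 then w₁ * w₂ / (w₁ + w₂) * (x 1 - x 2) ^ 2 else 0 else 0) := by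
      intro i j
      by_cases hij : (i = 0 ∧ j = 1) ∨ (i = 1 ∧ j = 0)
      · rcases hij with ⟨rfl, rfl⟩ | ⟨rfl, rfl⟩
        · simp only [SimpleGraph.comap_adj, Function.comp, hs1, hs2, h12, if_true, hedge]
          simp
          ring
        · simp only [SimpleGraph.comap_adj, Function.comp, hs1, hs2, h12.symm, if_true,
            hψ 1 0, hφ 2 1, abs_sub_comm (a 2), hedge]
          simp
          ring
      · rw [hrest i j hij]
        simp only [SimpleGraph.comap_adj, Function.comp, sub_self]
        grind
    simp only [hterm, Finset.sum_add_distrib]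
    simp
    ring
  rw [hrow, hblock]
  have hdot : (Fin.cons (-w₁ / (w₁ + w₂)) (Fin.cons (-w₂ / (w₁ + w₂)) 0) : Fin (n + 2) → ℝ) ⬝ᵥ
      (x ∘ Fin.succ) = -w₁ / (w₁ + w₂) * x 1 + -w₂ / (w₁ + w₂) * x 2 := by
    rw [dotProduct, Fin.sum_univ_succ, Fin.sum_univ_succ]
    simp [hs1]
  rw [hdot]
  by_cases hs : w₁ + w₂ = 0
  · obtain ⟨rfl, rfl⟩ := hw hs
    simp
  · field_simp
    ring

/-! ### Virtual interactions -/

lemma MemF.contDiffAt {f : ℝ → ℝ} (hf : MemF f) {d : ℝ} (hd : 0 < d) : ContDiffAt ℝ 1 f d :=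
  (hf.1 d hd).contDiffAt (Ioi_mem_nhds hd)

lemma MemF.hasStrictDerivAt_tildeFn {f : ℝ → ℝ} (hf : MemF f) {d : ℝ} (hd : 0 < d) :
    HasStrictDerivAt (tildeFn f) (deriv (tildeFn f) d) d :=
  ContDiffAt.hasStrictDerivAt (contDiffAt_id.mul (hf.contDiffAt hd)) one_ne_zero

lemma MemF.strictMonoOn_tildeFn {f : ℝ → ℝ} (hf : MemF f) :
    StrictMonoOn (tildeFn f) (Set.Ioi 0) :=
  strictMonoOn_of_deriv_pos (convex_Ioi 0)
    (fun _ hx => (hf.hasStrictDerivAt_tildeFn hx).hasDerivAt.continuousAt.continuousWithinAt)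
    fun x hx => hf.2.1 x (by simpa using hx)

/-- A function solving `F (d, φ d) = F (d₀, t₀)`, as the only possible solution near `(d₀, t₀)`,
is differentiable, with derivative given by implicit differentiation. -/
lemma hasDerivAt_of_unique_root {F : ℝ × ℝ → ℝ} {d₀ t₀ p q : ℝ} {φ : ℝ → ℝ}
    (hF : HasStrictFDerivAt F
      (p • ContinuousLinearMap.fst ℝ ℝ ℝ + q • ContinuousLinearMap.snd ℝ ℝ ℝ) (d₀, t₀))
    (hq : q ≠ 0) (hφ : ∀ᶠ v in 𝓝 (d₀, t₀), F v = F (d₀, t₀) → φ v.1 = v.2) :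
    φ d₀ = t₀ ∧ HasDerivAt φ (-p / q) d₀ := by
  have hinv : ((p • ContinuousLinearMap.fst ℝ ℝ ℝ + q • ContinuousLinearMap.snd ℝ ℝ ℝ) ∘L
      .inr ℝ ℝ ℝ).IsInvertible := by
    refine ⟨ContinuousLinearEquiv.unitsEquivAut ℝ (Units.mk0 q hq), ?_⟩
    ext
    simp
  set ψ := hF.implicitFunctionOfProdDomain hinv with hψ
  have h0 : φ d₀ = t₀ := hφ.self_of_nhds rfl
  have hψ0 : ψ d₀ = t₀ :=
    (hF.eventually_apply_eq_iff_implicitFunctionOfProdDomain hinv).self_of_nhds.1 rfl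
  have hψd := (hF.hasStrictFDerivAt_implicitFunctionOfProdDomain hinv).hasFDerivAt.hasDerivAt
  rw [← hψ] at hψd
  have hroot := hF.eventually_apply_implicitFunctionOfProdDomain hinv
  rw [← hψ] at hroot
  set c := (-((p • ContinuousLinearMap.fst ℝ ℝ ℝ + q • ContinuousLinearMap.snd ℝ ℝ ℝ) ∘L
      .inr ℝ ℝ ℝ).inverse ∘L ((p • ContinuousLinearMap.fst ℝ ℝ ℝ +
      q • ContinuousLinearMap.snd ℝ ℝ ℝ) ∘L .inl ℝ ℝ ℝ)) 1 with hc
  dsimp only at hψd hroot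
  have hpair : HasDerivAt (fun x => (x, ψ x)) (1, c) d₀ := (hasDerivAt_id d₀).prodMk hψd
  have hF' := hF.hasFDerivAt
  rw [← hψ0] at hF'
  have hcomp := hF'.comp_hasDerivAt d₀ hpair
  have hconst : HasDerivAt (F ∘ fun x => (x, ψ x)) 0 d₀ :=
    (hasDerivAt_const d₀ (F (d₀, t₀))).congr_of_eventuallyEq hroot
  have hlin := hcomp.unique hconst
  simp at hlin
  have hcval : c = -p / q := by
    field_simp
    linarith
  refine ⟨h0, ?_⟩
  rw [← hcval]
  refine hψd.congr_of_eventuallyEq ?_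
  have hcont : Tendsto (fun x => (x, ψ x)) (𝓝 d₀) (𝓝 (d₀, t₀)) := by
    have := hpair.continuousAt.tendsto
    rwa [hψ0] at this
  filter_upwards [hcont.eventually hφ, hroot] with x hx hr
  exact hx hr

/-- The derivative of `tildeFn (fun d => τ d / d)` is that of `τ` away from `0`. -/
lemma HasDerivAt.tildeFn_div {τ : ℝ → ℝ} {c d : ℝ} (h : HasDerivAt τ c d) (hd : 0 < d) :
    HasDerivAt (tildeFn fun d => τ d / d) c d := by
  refine h.congr_of_eventuallyEq ?_
  filter_upwards [Ioi_mem_nhds hd] with x hx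
  have : x ≠ 0 := (Set.mem_Ioi.1 hx).ne'
  simp only [tildeFn]
  field_simp

lemma case1d12_eq {f₁₂ f₁₃ : ℝ → ℝ} (h₁₂ : MemF f₁₂) (h₁₃ : MemF f₁₃) {d t : ℝ} (ht : 0 < t)
    (htd : t < d) (h : tildeFn f₁₂ t = tildeFn f₁₃ (d - t)) : case1d12 f₁₂ f₁₃ d = t := by
  obtain ⟨hs, hsd, hs'⟩ := Classical.epsilon_spec
    (p := fun t => 0 < t ∧ t < d ∧ tildeFn f₁₂ t = tildeFn f₁₃ (d - t)) ⟨t, ht, htd, h⟩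
  change 0 < case1d12 f₁₂ f₁₃ d at hs
  change case1d12 f₁₂ f₁₃ d < d at hsd
  change tildeFn f₁₂ (case1d12 f₁₂ f₁₃ d) = tildeFn f₁₃ (d - case1d12 f₁₂ f₁₃ d) at hs'
  set s := case1d12 f₁₂ f₁₃ d
  rcases lt_trichotomy s t with hlt | heq | hlt
  · have h1 := h₁₂.strictMonoOn_tildeFn hs ht hlt
    have h2 := h₁₃.strictMonoOn_tildeFn (sub_pos.2 htd) (sub_pos.2 hsd) (sub_lt_sub_left hlt d)
    linarith
  · exact heq
  · have h1 := h₁₂.strictMonoOn_tildeFn ht hs hlt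
    have h2 := h₁₃.strictMonoOn_tildeFn (sub_pos.2 hsd) (sub_pos.2 htd) (sub_lt_sub_left hlt d)
    linarith

lemma case2d12_eq {f₁₂ f₁₃ : ℝ → ℝ} (h₁₂ : MemF f₁₂) (h₁₃ : MemF f₁₃) {d t : ℝ} (ht : 0 < t)
    (hd : 0 < d) (h : tildeFn f₁₂ t + tildeFn f₁₃ (t + d) = 0) : case2d12 f₁₂ f₁₃ d = t := by
  obtain ⟨hs, hs'⟩ := Classical.epsilon_spec
    (p := fun t => 0 < t ∧ tildeFn f₁₂ t + tildeFn f₁₃ (t + d) = 0) ⟨t, ht, h⟩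
  change 0 < case2d12 f₁₂ f₁₃ d at hs
  change tildeFn f₁₂ (case2d12 f₁₂ f₁₃ d) + tildeFn f₁₃ (case2d12 f₁₂ f₁₃ d + d) = 0 at hs'
  set s := case2d12 f₁₂ f₁₃ d
  rcases lt_trichotomy s t with hlt | heq | hlt
  · have h1 := h₁₂.strictMonoOn_tildeFn hs ht hlt
    have h2 := h₁₃.strictMonoOn_tildeFn (add_pos hs hd) (add_pos ht hd) (add_lt_add_left hlt d)
    linarith
  · exact heq
  · have h1 := h₁₂.strictMonoOn_tildeFn ht hs hlt
    have h2 := h₁₃.strictMonoOn_tildeFn (add_pos ht hd) (add_pos hs hd) (add_lt_add_left hlt d)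
    linarith

lemma g23Case1_spec {f₁₂ f₁₃ : ℝ → ℝ} (h₁₂ : MemF f₁₂) (h₁₃ : MemF f₁₃) {t s : ℝ} (ht : 0 < t)
    (hs : 0 < s) (h : tildeFn f₁₂ t = tildeFn f₁₃ s) :
    g23Case1 f₁₂ f₁₃ (t + s) = tildeFn f₁₂ t / (t + s) ∧
    HasDerivAt (tildeFn (g23Case1 f₁₂ f₁₃))
      (deriv (tildeFn f₁₂) t * deriv (tildeFn f₁₃) s /
        (deriv (tildeFn f₁₂) t + deriv (tildeFn f₁₃) s)) (t + s) := by
  set u := deriv (tildeFn f₁₂) t with hu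
  set v := deriv (tildeFn f₁₃) s with hv
  have hu0 : 0 < u := h₁₂.2.1 t ht
  have hv0 : 0 < v := h₁₃.2.1 s hs
  have hsub : t + s - t = s := by ring
  have hF : HasStrictFDerivAt (fun z : ℝ × ℝ => tildeFn f₁₂ z.2 - tildeFn f₁₃ (z.1 - z.2))
      ((-v) • ContinuousLinearMap.fst ℝ ℝ ℝ + (u + v) • ContinuousLinearMap.snd ℝ ℝ ℝ)
      (t + s, t) := by
    have h1 : HasStrictFDerivAt (fun z : ℝ × ℝ => tildeFn f₁₂ z.2)
        (u • ContinuousLinearMap.snd ℝ ℝ ℝ) (t + s, t) :=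
      HasStrictDerivAt.comp_hasStrictFDerivAt (t + s, t) (h₁₂.hasStrictDerivAt_tildeFn ht)
        hasStrictFDerivAt_snd
    have h2 : HasStrictFDerivAt (fun z : ℝ × ℝ => tildeFn f₁₃ (z.1 - z.2))
        (v • (ContinuousLinearMap.fst ℝ ℝ ℝ - ContinuousLinearMap.snd ℝ ℝ ℝ)) (t + s, t) := by
      have h3 : HasStrictFDerivAt (fun z : ℝ × ℝ => z.1 - z.2)
          (ContinuousLinearMap.fst ℝ ℝ ℝ - ContinuousLinearMap.snd ℝ ℝ ℝ) (t + s, t) :=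
        hasStrictFDerivAt_fst.sub hasStrictFDerivAt_snd
      have h4 : HasStrictDerivAt (tildeFn f₁₃) v (t + s - t) := by
        rw [hsub]
        exact h₁₃.hasStrictDerivAt_tildeFn hs
      exact HasStrictDerivAt.comp_hasStrictFDerivAt (t + s, t) h4 h3
    refine (h1.sub h2).congr_fderiv ?_
    module
  obtain ⟨hφ, hφ'⟩ := hasDerivAt_of_unique_root (φ := case1d12 f₁₂ f₁₃) hF (by positivity) (by
    have hev : ∀ᶠ v : ℝ × ℝ in 𝓝 (t + s, t), 0 < v.2 ∧ v.2 < v.1 :=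
      ((isOpen_lt continuous_const continuous_snd).inter
        (isOpen_lt continuous_snd continuous_fst)).mem_nhds ⟨ht, by simpa using hs⟩
    filter_upwards [hev] with z hz hz'
    refine case1d12_eq h₁₂ h₁₃ hz.1 hz.2 ?_
    simp only [hsub, h] at hz'
    linarith)
  refine ⟨by rw [g23Case1, hφ], ?_⟩
  have hτ := (h₁₂.hasStrictDerivAt_tildeFn ht).hasDerivAt
  rw [← hφ] at hτ
  have := HasDerivAt.tildeFn_div (HasDerivAt.comp _ hτ hφ') (add_pos ht hs)
  rw [hφ] at this
  convert! this using 1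
  ring

lemma g23Case2_spec {f₁₂ f₁₃ : ℝ → ℝ} (h₁₂ : MemF f₁₂) (h₁₃ : MemF f₁₃) {t d : ℝ} (ht : 0 < t)
    (hd : 0 < d) (h : tildeFn f₁₂ t + tildeFn f₁₃ (t + d) = 0) :
    g23Case2 f₁₂ f₁₃ d = tildeFn f₁₃ (t + d) / d ∧
    HasDerivAt (tildeFn (g23Case2 f₁₂ f₁₃))
      (deriv (tildeFn f₁₂) t * deriv (tildeFn f₁₃) (t + d) /
        (deriv (tildeFn f₁₂) t + deriv (tildeFn f₁₃) (t + d))) d := by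
  set u := deriv (tildeFn f₁₂) t with hu
  set v := deriv (tildeFn f₁₃) (t + d) with hv
  have hs : 0 < t + d := add_pos ht hd
  have hu0 : 0 < u := h₁₂.2.1 t ht
  have hv0 : 0 < v := h₁₃.2.1 _ hs
  have hF : HasStrictFDerivAt (fun z : ℝ × ℝ => tildeFn f₁₂ z.2 + tildeFn f₁₃ (z.2 + z.1))
      (v • ContinuousLinearMap.fst ℝ ℝ ℝ + (u + v) • ContinuousLinearMap.snd ℝ ℝ ℝ)
      (d, t) := by
    have h1 : HasStrictFDerivAt (fun z : ℝ × ℝ => tildeFn f₁₂ z.2)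
        (u • ContinuousLinearMap.snd ℝ ℝ ℝ) (d, t) :=
      HasStrictDerivAt.comp_hasStrictFDerivAt (d, t) (h₁₂.hasStrictDerivAt_tildeFn ht)
        hasStrictFDerivAt_snd
    have h2 : HasStrictFDerivAt (fun z : ℝ × ℝ => tildeFn f₁₃ (z.2 + z.1))
        (v • (ContinuousLinearMap.snd ℝ ℝ ℝ + ContinuousLinearMap.fst ℝ ℝ ℝ)) (d, t) :=
      HasStrictDerivAt.comp_hasStrictFDerivAt (d, t) (h₁₃.hasStrictDerivAt_tildeFn hs)
        (hasStrictFDerivAt_snd.add hasStrictFDerivAt_fst)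
    refine (h1.add h2).congr_fderiv ?_
    module
  obtain ⟨hφ, hφ'⟩ := hasDerivAt_of_unique_root (φ := case2d12 f₁₂ f₁₃) hF (by positivity) (by
    have hev : ∀ᶠ v : ℝ × ℝ in 𝓝 (d, t), 0 < v.2 ∧ 0 < v.1 :=
      ((isOpen_lt continuous_const continuous_snd).inter
        (isOpen_lt continuous_const continuous_fst)).mem_nhds ⟨ht, hd⟩
    filter_upwards [hev] with z hz hz'
    exact case2d12_eq h₁₂ h₁₃ hz.1 hz.2 (hz'.trans h))
  refine ⟨by rw [g23Case2, hφ], ?_⟩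
  have hτ := (h₁₃.hasStrictDerivAt_tildeFn hs).hasDerivAt
  rw [← hv, ← hφ] at hτ
  have hsum : HasDerivAt (fun x => case2d12 f₁₂ f₁₃ x + x) (-v / (u + v) + 1) d :=
    hφ'.add (hasDerivAt_id d)
  have := HasDerivAt.tildeFn_div (HasDerivAt.comp (h := fun x => case2d12 f₁₂ f₁₃ x + x) d hτ hsum) hd
  convert! this using 1
  field_simp
  ring

/-- At a line equilibrium the virtual interaction is the series composition of the interactions of
agent `1`, both for the weights and for the derivatives of the scaled laws. -/
lemma virtualG_spec {f₁₂ f₁₃ : ℝ → ℝ} (h₁₂ : MemF f₁₂) (h₁₃ : MemF f₁₃) {x y z : ℝ} (hxy : x ≠ y)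
    (hxz : x ≠ z) (hyz : y ≠ z) (h : f₁₂ |x - y| * (y - x) + f₁₃ |x - z| * (z - x) = 0) :
    (f₁₂ |x - y| + f₁₃ |x - z| = 0 → f₁₂ |x - y| = 0 ∧ f₁₃ |x - z| = 0) ∧
    virtualG f₁₂ f₁₃ x y z |y - z| =
      f₁₂ |x - y| * f₁₃ |x - z| / (f₁₂ |x - y| + f₁₃ |x - z|) ∧
    HasDerivAt (tildeFn (virtualG f₁₂ f₁₃ x y z))
      (deriv (tildeFn f₁₂) |x - y| * deriv (tildeFn f₁₃) |x - z| /
        (deriv (tildeFn f₁₂) |x - y| + deriv (tildeFn f₁₃) |x - z|)) |y - z| := by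
  set p := f₁₂ |x - y| with hp
  set q := f₁₃ |x - z| with hq
  have hzero : p + q = 0 → p = 0 ∧ q = 0 := by
    intro hpq
    have h1 : p * (y - z) = 0 := by linear_combination h - (z - x) * hpq
    have h2 : p = 0 := (mul_eq_zero.1 h1).resolve_right (sub_ne_zero.2 hyz)
    exact ⟨h2, by linarith⟩
  have hd1 : 0 < |x - y| := abs_pos.2 (sub_ne_zero.2 hxy)
  have hd2 : 0 < |x - z| := abs_pos.2 (sub_ne_zero.2 hxz)
  have hd3 : 0 < |y - z| := abs_pos.2 (sub_ne_zero.2 hyz)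
  refine ⟨hzero, ?_⟩
  have hseries : ∀ {τ : ℝ}, |y - z| * (p * q) = τ * (p + q) → (p + q = 0 → τ = 0) →
      τ / |y - z| = p * q / (p + q) := by
    intro τ h1 h2
    by_cases hpq : p + q = 0
    · simp [hpq, h2 hpq]
    · rw [div_eq_div_iff hd3.ne' hpq]
      linarith
  unfold virtualG
  split_ifs with hc1 hc2
  · have hsum : |y - z| = |x - y| + |x - z| := by
      rcases hc1 with ⟨h1, h2⟩ | ⟨h1, h2⟩
      · rw [abs_of_neg (by linarith : y - z < 0), abs_of_pos (by linarith : 0 < x - y),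
          abs_of_neg (by linarith : x - z < 0)]
        ring
      · rw [abs_of_pos (by linarith : 0 < y - z), abs_of_neg (by linarith : x - y < 0),
          abs_of_pos (by linarith : 0 < x - z)]
        ring
    have hbal : |x - y| * p = |x - z| * q := by
      rcases hc1 with ⟨h1, h2⟩ | ⟨h1, h2⟩
      · rw [abs_of_pos (by linarith : 0 < x - y), abs_of_neg (by linarith : x - z < 0)]
        linarith
      · rw [abs_of_neg (by linarith : x - y < 0), abs_of_pos (by linarith : 0 < x - z)]
        linarith
    obtain ⟨hv, hv'⟩ := g23Case1_spec h₁₂ h₁₃ hd1 hd2 hbal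
    rw [← hsum] at hv hv'
    refine ⟨hv.trans (hseries ?_ ?_), hv'⟩
    · rw [hsum, tildeFn, ← hp]
      linear_combination -p * hbal
    · intro h0
      rw [tildeFn, ← hp, (hzero h0).1, mul_zero]
  · have hsum : |x - z| = |x - y| + |y - z| := by
      rcases hc2 with ⟨h1, h2⟩ | ⟨h1, h2⟩
      · rw [abs_of_neg (by linarith : y - z < 0), abs_of_neg (by linarith : x - y < 0),
          abs_of_neg (by linarith : x - z < 0)]
        ring
      · rw [abs_of_pos (by linarith : 0 < y - z), abs_of_pos (by linarith : 0 < x - y),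
          abs_of_pos (by linarith : 0 < x - z)]
        ring
    have hbal : |x - y| * p + |x - z| * q = 0 := by
      rcases hc2 with ⟨h1, h2⟩ | ⟨h1, h2⟩
      · rw [abs_of_neg (by linarith : x - y < 0), abs_of_neg (by linarith : x - z < 0)]
        linarith
      · rw [abs_of_pos (by linarith : 0 < x - y), abs_of_pos (by linarith : 0 < x - z)]
        linarith
    obtain ⟨hv, hv'⟩ := g23Case2_spec h₁₂ h₁₃ hd1 hd3 (by rw [← hsum]; exact hbal)
    rw [← hsum] at hv hv'
    refine ⟨hv.trans (hseries ?_ ?_), hv'⟩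
    · rw [tildeFn, ← hq]
      linear_combination -q * hbal - p * q * hsum
    · intro h0
      rw [tildeFn, ← hq, (hzero h0).2, mul_zero]
  · have hc3 : (x < z ∧ z < y) ∨ (y < z ∧ z < x) := by
      rcases lt_or_gt_of_ne hxy with h1 | h1 <;> rcases lt_or_gt_of_ne hxz with h2 | h2 <;>
        rcases lt_or_gt_of_ne hyz with h3 | h3 <;> grind
    have hsum : |x - y| = |x - z| + |y - z| := by
      rcases hc3 with ⟨h1, h2⟩ | ⟨h1, h2⟩
      · rw [abs_of_pos (by linarith : 0 < y - z), abs_of_neg (by linarith : x - y < 0),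
          abs_of_neg (by linarith : x - z < 0)]
        ring
      · rw [abs_of_neg (by linarith : y - z < 0), abs_of_pos (by linarith : 0 < x - y),
          abs_of_pos (by linarith : 0 < x - z)]
        ring
    have hbal : |x - z| * q + |x - y| * p = 0 := by
      rcases hc3 with ⟨h1, h2⟩ | ⟨h1, h2⟩
      · rw [abs_of_neg (by linarith : x - y < 0), abs_of_neg (by linarith : x - z < 0)]
        linarith
      · rw [abs_of_pos (by linarith : 0 < x - y), abs_of_pos (by linarith : 0 < x - z)]
        linarith
    obtain ⟨hv, hv'⟩ := g23Case2_spec h₁₃ h₁₂ hd2 hd3 (by rw [← hsum]; exact hbal)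
    rw [← hsum] at hv hv'
    refine ⟨hv.trans (hseries ?_ ?_), ?_⟩
    · rw [tildeFn, ← hp]
      linear_combination -p * hbal - p * q * hsum
    · intro h0
      rw [tildeFn, ← hp, (hzero h0).1, mul_zero]
    · rw [mul_comm (deriv (tildeFn f₁₂) _), add_comm (deriv (tildeFn f₁₂) _)]
      exact hv'

lemma IsEquilibrium.sum_zero_one_two {n : ℕ} {G : SimpleGraph (Fin (n + 3))}
    (h0 : G.neighborSet 0 = {1, 2}) {f : Fin (n + 3) → Fin (n + 3) → ℝ → ℝ}
    {a : Fin (n + 3) → ℝ} (heq : IsEquilibrium G f (lineConfig a)) :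
    f 0 1 |a 0 - a 1| * (a 1 - a 0) + f 0 2 |a 0 - a 2| * (a 2 - a 0) = 0 := by
  have hadj : ∀ j, G.Adj 0 j ↔ j = 1 ∨ j = 2 := fun j => by
    rw [← SimpleGraph.mem_neighborSet, h0]; rfl
  have hs1 : (Fin.succ 0 : Fin (n + 3)) = 1 := rfl
  have hs2 : (Fin.succ 1 : Fin (n + 3)) = 2 := rfl
  have hs2' : (Fin.succ (Fin.succ 0) : Fin (n + 3)) = 2 := rfl
  have hs1' : (Fin.succ 0 : Fin (n + 2)) = 1 := rfl
  have h := congrArg Prod.fst (heq 0)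
  rw [Prod.fst_sum, Fin.sum_univ_succ, Fin.sum_univ_succ, Fin.sum_univ_succ,
    Finset.sum_eq_zero, hs1, hs2', if_neg G.irrefl, if_pos ((hadj 1).2 (Or.inl rfl)),
    if_pos ((hadj 2).2 (Or.inr rfl))] at h
  · simpa [lineConfig, dist2, Real.sqrt_sq_eq_abs] using h
  · intro j _
    rw [if_neg]
    · rfl
    · rw [hadj, ← hs1, ← hs2, Fin.succ_inj, Fin.succ_inj, ← hs1', Fin.succ_inj]
      simp [Fin.succ_ne_zero]

/-- the inertia formula `𝐧(H_p) − 𝐧(H_{p*}) = sgn(−f₁₂(d₁₂) − f₁₃(d₁₃))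
+ sgn(−f̃′₁₂(d₁₂) − f̃′₁₃(d₁₃))`, where `H_p = diag(d̃F_p, F_p)` and `H_{p*}` is the
corresponding block matrix of the reduced system associated with `p`. -/
theorem statement2 {n : ℕ} (G : SimpleGraph (Fin (n+3))) (hG : IsTLG G)
    (h0 : G.neighborSet 0 = {1, 2}) (h12 : G.Adj 1 2)
    (f : Fin (n+3) → Fin (n+3) → ℝ → ℝ)
    (hsym : ∀ i j, f i j = f j i)
    (hF : ∀ i j, G.Adj i j → MemF (f i j))
    (a : Fin (n+3) → ℝ)
    (hP : ∀ i j, G.Adj i j → a i ≠ a j)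
    (heq : IsEquilibrium G f (lineConfig a)) :
    inertia (Matrix.fromBlocks (dFMat G f a) 0 0 (FMat G f a))
      = inertia (Matrix.fromBlocks
            (dFMat (G.comap Fin.succ)
              (reducedLaws f (virtualG (f 0 1) (f 0 2) (a 0) (a 1) (a 2))) (a ∘ Fin.succ))
            0 0
            (FMat (G.comap Fin.succ)
              (reducedLaws f (virtualG (f 0 1) (f 0 2) (a 0) (a 1) (a 2))) (a ∘ Fin.succ)))
        + sgn3 (-(f 0 1 |a 0 - a 1|) - f 0 2 |a 0 - a 2|)
        + sgn3 (-(deriv (tildeFn (f 0 1)) |a 0 - a 1|)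
                - deriv (tildeFn (f 0 2)) |a 0 - a 2|) := by
  set g := virtualG (f 0 1) (f 0 2) (a 0) (a 1) (a 2) with hg
  have hadj : ∀ j, G.Adj 0 j ↔ j = 1 ∨ j = 2 := fun j => by
    rw [← SimpleGraph.mem_neighborSet, h0]; rfl
  have h01 : G.Adj 0 1 := (hadj 1).2 (Or.inl rfl)
  have h02 : G.Adj 0 2 := (hadj 2).2 (Or.inr rfl)
  obtain ⟨hzero, hval, hder⟩ := virtualG_spec (hF 0 1 h01) (hF 0 2 h02) (hP 0 1 h01) (hP 0 2 h02)
    (hP 1 2 h12) (heq.sum_zero_one_two h0)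
  rw [← hg] at hval hder
  have hrsym : ∀ i j, reducedLaws f g i j = reducedLaws f g j i := by
    intro i j
    have : ((i = 0 ∧ j = 1) ∨ (i = 1 ∧ j = 0)) ↔ ((j = 0 ∧ i = 1) ∨ (j = 1 ∧ i = 0)) := by tauto
    simp only [reducedLaws, this, hsym i.succ j.succ]
  have hedge : reducedLaws f g 0 1 = fun d => f 1 2 d + g d := if_pos (Or.inl ⟨rfl, rfl⟩)
  have hrest : ∀ i j, ¬ ((i = 0 ∧ j = 1) ∨ (i = 1 ∧ j = 0)) →
      reducedLaws f g i j = f i.succ j.succ := fun i j h => if_neg h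
  have hd : 0 < |a 1 - a 2| := abs_pos.2 (sub_ne_zero.2 (hP 1 2 h12))
  have hu : 0 < deriv (tildeFn (f 0 1)) |a 0 - a 1| :=
    (hF 0 1 h01).2.1 _ (abs_pos.2 (sub_ne_zero.2 (hP 0 1 h01)))
  have hv : 0 < deriv (tildeFn (f 0 2)) |a 0 - a 2| :=
    (hF 0 2 h02).2.1 _ (abs_pos.2 (sub_ne_zero.2 (hP 0 2 h02)))
  have hdsym : ∀ i j, (fun d => deriv (tildeFn (f i j)) d) = fun d => deriv (tildeFn (f j i)) d :=
    fun i j => by rw [hsym]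
  have hdrsym : ∀ i j, (fun d => deriv (tildeFn (reducedLaws f g i j)) d) =
      fun d => deriv (tildeFn (reducedLaws f g j i)) d := fun i j => by rw [hrsym]
  have hsumder : deriv (tildeFn (reducedLaws f g 0 1)) |a 1 - a 2| =
      deriv (tildeFn (f 1 2)) |a 1 - a 2| + deriv (tildeFn (f 0 1)) |a 0 - a 1| *
        deriv (tildeFn (f 0 2)) |a 0 - a 2| /
        (deriv (tildeFn (f 0 1)) |a 0 - a 1| + deriv (tildeFn (f 0 2)) |a 0 - a 2|) := by
    have h1 : tildeFn (reducedLaws f g 0 1) = tildeFn (f 1 2) + tildeFn g := by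
      ext d
      simp only [hedge, tildeFn, Pi.add_apply]
      ring
    rw [h1]
    exact (((hF 1 2 h12).hasStrictDerivAt_tildeFn hd).hasDerivAt.add hder).deriv
  unfold dFMat
  rw [inertia_fromBlocks_zero (FMat_isHermitian _ hdsym _) (FMat_isHermitian _ hsym _),
    inertia_fromBlocks_zero (FMat_isHermitian _ hdrsym _) (FMat_isHermitian _ hrsym _)]
  have hFM := inertia_FMat_eq_comap_succ G h0 h12 hsym hrsym a rfl rfl hzero
    (by rw [hedge, ← hval]) hrest
  have hdFM := inertia_FMat_eq_comap_succ G h0 h12 hdsym hdrsym a rfl rfl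
    (fun h => absurd h (by positivity)) hsumder (fun i j h => by rw [hrest i j h])
  rw [hFM, hdFM]
  abel
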